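/- arXiv:1201.0740 — 2 statements merged into one kernel-verified Lean document; each statement's English description precedes it below -/
import Mathlib

section
/- Let n ≥ 1 and let m, p : Fin n → ℕ be multi-indices with m ≠ p. Then the integral over the unit sphere S^{2n−1} = {z ∈ ℂⁿ : ‖z‖ = 1}, with respect to its spherical surface measure σ (the measure obtained from Lebesgue measure on ℂⁿ ≅ ℝ^{2n} by polar disintegration), of the function z ↦ ∏_{j} z_j^{m_j} · conj(z_j)^{p_j} equals 0: ∫_{S^{2n−1}} z₁^{m₁}⋯zₙ^{mₙ}·z̄₁^{p₁}⋯z̄ₙ^{pₙ} dσ(z) = 0. (Orthogonality of distinct spherical monomials, established in the proof of the paper's Lemma 5.3.) -/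
open MeasureTheory

/-- Borel measurable structure on `ℂⁿ` (with the Euclidean norm `‖z‖² = Σ|z_j|²`). -/
noncomputable instance euclideanComplexMeasurableSpace {ι : Type*} :
    MeasurableSpace (EuclideanSpace ℂ ι) := borel _

instance euclideanComplexBorelSpace {ι : Type*} : BorelSpace (EuclideanSpace ℂ ι) := ⟨rfl⟩

/-- The real inner product space structure on `ℂⁿ` obtained by restriction of scalars;
together with `measureSpaceOfInnerProductSpace` this endows `ℂⁿ ≅ ℝ^{2n}` with its
Lebesgue measure (`volume`). -/
noncomputable instance euclideanComplexRealInner {ι : Type*} [Fintype ι] :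
    InnerProductSpace ℝ (EuclideanSpace ℂ ι) := InnerProductSpace.complexToReal

open scoped Pointwise in
/-- A linear isometry preserving `μ` preserves the induced spherical measure. -/
theorem integral_toSphere_comp_linearIsometryEquiv
    {E F : Type*} [NormedAddCommGroup E] [NormedSpace ℝ E] [MeasurableSpace E] [BorelSpace E]
    [NormedAddCommGroup F] [NormedSpace ℝ F] (μ : Measure E) (L : E ≃ₗᵢ[ℝ] E)
    (hL : MeasurePreserving L μ μ) (f : E → F) :
    ∫ z : Metric.sphere (0 : E) 1, f (L z) ∂μ.toSphere =
      ∫ z : Metric.sphere (0 : E) 1, f z ∂μ.toSphere := by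
  let φ : Metric.sphere (0 : E) 1 ≃ₜ Metric.sphere (0 : E) 1 :=
    L.toHomeomorph.subtype fun z => by simp
  have hφ (z : Metric.sphere (0 : E) 1) : (φ z : E) = L z := rfl
  have hmp : MeasurePreserving φ μ.toSphere μ.toSphere := by
    refine ⟨φ.continuous.measurable, Measure.ext fun s hs => ?_⟩
    have hs' := φ.continuous.measurable hs
    rw [Measure.map_apply φ.continuous.measurable hs, Measure.toSphere_apply' μ hs,
      Measure.toSphere_apply' μ hs']
    congr 1
    rw [← hL.measure_preimage_emb L.toHomeomorph.measurableEmbedding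
      (Set.Ioo (0 : ℝ) 1 • (Subtype.val '' s))]
    congr 1
    ext x
    simp only [Set.mem_smul, Set.mem_image, Set.mem_preimage]
    constructor
    · rintro ⟨r, hr, _, ⟨z, hz, rfl⟩, rfl⟩
      exact ⟨r, hr, _, ⟨φ z, hz, rfl⟩, by simp [hφ]⟩
    · rintro ⟨r, hr, _, ⟨z, hz, rfl⟩, h⟩
      refine ⟨r, hr, _, ⟨φ.symm z, by simpa using hz, rfl⟩, L.injective ?_⟩
      rw [map_smul, ← hφ, φ.apply_symm_apply, h]
  exact hmp.integral_comp φ.measurableEmbedding fun z => f z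

/-- For distinct exponents some unit complex number is scaled to `-1` by the mixed monomial. -/
theorem exists_circle_pow_mul_conj_pow_eq_neg_one {a b : ℕ} (hab : a ≠ b) :
    ∃ c : Circle, (c : ℂ) ^ a * (starRingEnd ℂ) (c : ℂ) ^ b = -1 := by
  have h : (a : ℂ) - b ≠ 0 := sub_ne_zero.mpr (by exact_mod_cast hab)
  refine ⟨Circle.exp (Real.pi / ((a : ℝ) - b)), ?_⟩
  rw [Circle.coe_exp, ← Complex.exp_conj, ← Complex.exp_nat_mul, ← Complex.exp_nat_mul,
    ← Complex.exp_add, ← Complex.exp_pi_mul_I]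
  congr 1
  simp only [map_mul, Complex.conj_ofReal, Complex.conj_I]
  push_cast
  field_simp
  ring

theorem sphere_monomial_orthogonality
    (n : ℕ) (hn : 1 ≤ n) (m p : Fin n → ℕ) (hmp : m ≠ p) :
    ∫ z : Metric.sphere (0 : EuclideanSpace ℂ (Fin n)) 1,
        ∏ j : Fin n,
          ((z : EuclideanSpace ℂ (Fin n)) j ^ m j *
            (starRingEnd ℂ) ((z : EuclideanSpace ℂ (Fin n)) j) ^ p j)
      ∂((volume : Measure (EuclideanSpace ℂ (Fin n))).toSphere) = 0 := by
  obtain ⟨k, hk⟩ := Function.ne_iff.mp hmp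
  obtain ⟨c, hc⟩ := exists_circle_pow_mul_conj_pow_eq_neg_one hk
  let d : Fin n → Circle := Function.update 1 k c
  let L : EuclideanSpace ℂ (Fin n) ≃ₗᵢ[ℝ] EuclideanSpace ℂ (Fin n) :=
    LinearIsometryEquiv.piLpCongrRight 2 fun i => rotation (d i)
  have hLapp (z : EuclideanSpace ℂ (Fin n)) (j : Fin n) : L z j = d j * z j := rfl
  have hd : ∏ j, ((d j : ℂ) ^ m j * (starRingEnd ℂ) (d j : ℂ) ^ p j) = -1 := by
    rw [Finset.prod_eq_single k _ (by simp)]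
    · simpa [d] using hc
    · intro j _ hj
      simp [d, hj]
  have key := integral_toSphere_comp_linearIsometryEquiv volume L L.measurePreserving
    fun z => ∏ j : Fin n, (z j ^ m j * (starRingEnd ℂ) (z j) ^ p j)
  have hneg (z : EuclideanSpace ℂ (Fin n)) :
      ∏ j : Fin n, (L z j ^ m j * (starRingEnd ℂ) (L z j) ^ p j) =
        -∏ j : Fin n, (z j ^ m j * (starRingEnd ℂ) (z j) ^ p j) := by
    rw [neg_eq_neg_one_mul, ← hd, ← Finset.prod_mul_distrib]
    refine Finset.prod_congr rfl fun j _ => ?_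
    rw [hLapp, map_mul]
    ring
  simp only [hneg, integral_neg] at key
  exact self_eq_neg.mp key.symm
end

section
/- Fix an integer n ≥ 1. For each integer k ≥ 2 set I_k := ∫_{z ∈ ℂⁿ, ‖z‖ ≤ (log k)/√k} (1 − ‖z‖²)^k dV(z) and J_k := ∫_{z ∈ ℂⁿ, ‖z‖ ≤ (log k)/√k} |z₁|²·(1 − ‖z‖²)^k dV(z), where dV is Lebesgue measure on ℂⁿ ≅ ℝ^{2n}. Then there exist a constant C > 0 and an integer k₀ ≥ 2 such that for all k ≥ k₀ one has J_k > 0 and |I_k/(k·J_k) − 1| ≤ C/k. (The asymptotic I_k/(k·J_k) ∼ 1 + O(1/k) used in the proof of the paper's Lemma 5.4, estimate (5.7).) -/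
open MeasureTheory

/-- Integration of a radial function over a ball of `ℂⁿ` in polar coordinates. -/
theorem setIntegral_closedBall_radial {n : ℕ} (hn : 1 ≤ n) (g : ℝ → ℝ) {R : ℝ} (hR : 0 ≤ R) :
    ∫ z in Metric.closedBall (0 : EuclideanSpace ℂ (Fin n)) R, g ‖z‖ =
      2 * n * (volume : Measure (EuclideanSpace ℂ (Fin n))).real (Metric.ball 0 1) *
        ∫ r in (0 : ℝ)..R, r ^ (2 * n - 1) * g r := by
  have hdim : Module.finrank ℝ (EuclideanSpace ℂ (Fin n)) = 2 * n :=
    (finrank_real_of_complex (EuclideanSpace ℂ (Fin n))).trans (by simp)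
  have : Nontrivial (EuclideanSpace ℂ (Fin n)) :=
    Module.nontrivial_of_finrank_pos (R := ℝ) (by rw [hdim]; omega)
  have hind : ∀ z : EuclideanSpace ℂ (Fin n),
      (Metric.closedBall 0 R).indicator (fun z => g ‖z‖) z = (Set.Iic R).indicator g ‖z‖ := by
    intro z
    by_cases h : ‖z‖ ≤ R <;> simp [Set.indicator, h]
  have hpolar : ∀ r : ℝ, r ^ (2 * n - 1) • (Set.Iic R).indicator g r =
      (Set.Iic R).indicator (fun r => r ^ (2 * n - 1) * g r) r := by
    intro r
    by_cases h : r ≤ R <;> simp [Set.indicator, h]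
  rw [← integral_indicator Metric.isClosed_closedBall.measurableSet]
  simp_rw [hind]
  rw [integral_fun_norm_addHaar, hdim]
  simp_rw [hpolar]
  rw [setIntegral_indicator measurableSet_Iic, Set.Ioi_inter_Iic,
    intervalIntegral.integral_of_le hR, nsmul_eq_mul, smul_eq_mul]
  push_cast
  ring

/-- Coordinate permutations of `ℂⁿ` preserve Lebesgue measure. -/
theorem measurePreserving_piLpCongrLeft {n : ℕ} (e : Equiv.Perm (Fin n)) :
    MeasurePreserving (LinearIsometryEquiv.piLpCongrLeft 2 ℂ ℂ e :
      EuclideanSpace ℂ (Fin n) → EuclideanSpace ℂ (Fin n)) := by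
  let f : EuclideanSpace ℂ (Fin n) ≃ₗᵢ[ℝ] EuclideanSpace ℂ (Fin n) :=
    { LinearIsometryEquiv.piLpCongrLeft 2 ℂ ℂ e with
      map_smul' := fun c x => (LinearIsometryEquiv.piLpCongrLeft 2 ℂ ℂ e).map_smul (c : ℂ) x }
  exact f.measurePreserving

theorem setIntegral_closedBall_coord_eq {n : ℕ} (g : ℝ → ℝ) (R : ℝ) (i j : Fin n) :
    ∫ z in Metric.closedBall (0 : EuclideanSpace ℂ (Fin n)) R, ‖z i‖ ^ 2 * g ‖z‖ =
      ∫ z in Metric.closedBall (0 : EuclideanSpace ℂ (Fin n)) R, ‖z j‖ ^ 2 * g ‖z‖ := by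
  set T := LinearIsometryEquiv.piLpCongrLeft 2 ℂ ℂ (Equiv.swap i j) with hT
  have hpre : T ⁻¹' Metric.closedBall (0 : EuclideanSpace ℂ (Fin n)) R =
      Metric.closedBall 0 R := by
    ext z; simp
  have h := (measurePreserving_piLpCongrLeft (Equiv.swap i j)).setIntegral_preimage_emb
    T.toHomeomorph.measurableEmbedding (fun z => ‖z i‖ ^ 2 * g ‖z‖) (Metric.closedBall 0 R)
  rw [← hT, hpre] at h
  rw [← h]
  refine integral_congr_ae (ae_of_all _ fun z => ?_)
  simp [hT, LinearIsometryEquiv.piLpCongrLeft_apply, Equiv.piCongrLeft']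

/-- Averaging over the coordinates turns a coordinate moment into a radial one. -/
theorem mul_setIntegral_closedBall_coord {n : ℕ} {g : ℝ → ℝ} (hg : Continuous g) (R : ℝ)
    (i : Fin n) :
    n * ∫ z in Metric.closedBall (0 : EuclideanSpace ℂ (Fin n)) R, ‖z i‖ ^ 2 * g ‖z‖ =
      ∫ z in Metric.closedBall (0 : EuclideanSpace ℂ (Fin n)) R, ‖z‖ ^ 2 * g ‖z‖ := by
  simp_rw [EuclideanSpace.norm_sq_eq, Finset.sum_mul]
  rw [integral_finsetSum]
  · rw [Finset.sum_congr rfl fun j _ => setIntegral_closedBall_coord_eq g R j i]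
    simp
  · intro j _
    have : Continuous fun z : EuclideanSpace ℂ (Fin n) => ‖z j‖ ^ 2 * g ‖z‖ := by fun_prop
    exact this.continuousOn.integrableOn_compact (isCompact_closedBall _ _)

/-- Integration by parts relating consecutive radial moments of `(1 - r²)ᵏ`. -/
theorem radial_moment_recursion {n : ℕ} (hn : 1 ≤ n) (k : ℕ) (R : ℝ) :
    2 * n * ∫ r in (0 : ℝ)..R, r ^ (2 * n - 1) * (1 - r ^ 2) ^ k =
      2 * (n + k + 1) * (∫ r in (0 : ℝ)..R, r ^ (2 * n + 1) * (1 - r ^ 2) ^ k) +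
        R ^ (2 * n) * (1 - R ^ 2) ^ (k + 1) := by
  obtain ⟨m, rfl⟩ : ∃ m, n = m + 1 := ⟨n - 1, by omega⟩
  have hexp : 2 * (m + 1) - 1 = 2 * m + 1 := by omega
  have hderiv : ∀ r ∈ Set.uIcc 0 R,
      HasDerivAt (fun r : ℝ => r ^ (2 * (m + 1)) * (1 - r ^ 2) ^ (k + 1))
        (2 * (m + 1 : ℝ) * (r ^ (2 * m + 1) * (1 - r ^ 2) ^ k) -
          2 * ((m + 1 : ℝ) + k + 1) * (r ^ (2 * (m + 1) + 1) * (1 - r ^ 2) ^ k)) r := by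
    intro r _
    have h := (hasDerivAt_pow (2 * (m + 1)) r).mul
      (((hasDerivAt_pow 2 r).const_sub 1).pow (k + 1))
    refine h.congr_deriv ?_
    simp only [hexp, Nat.add_sub_cancel, Pi.pow_apply]
    push_cast
    ring
  have h := intervalIntegral.integral_eq_sub_of_hasDerivAt hderiv
    (Continuous.intervalIntegrable (by fun_prop) _ _)
  rw [intervalIntegral.integral_sub (Continuous.intervalIntegrable (by fun_prop) _ _)
    (Continuous.intervalIntegrable (by fun_prop) _ _), intervalIntegral.integral_const_mul,
    intervalIntegral.integral_const_mul] at h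
  rw [hexp]
  push_cast
  simp only [zero_pow (show 2 * (m + 1) ≠ 0 by omega), zero_mul, sub_zero] at h
  linarith

/-- The radial moment is at least its part over `r ≤ 1 / √(2 * k)`, where `(1 - r²)ᵏ ≥ 1 / 2`. -/
theorem radial_moment_lower_bound (n : ℕ) {k : ℕ} (hk : 1 ≤ k) {R : ℝ}
    (hR : (1 / k : ℝ) ≤ R ^ 2) (hR0 : 0 ≤ R) (hR1 : R ≤ 1) :
    (1 / k : ℝ) ^ (n + 1) ≤ 2 ^ (n + 3) * (n + 1) *
      ∫ r in (0 : ℝ)..R, r ^ (2 * n + 1) * (1 - r ^ 2) ^ k := by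
  have hk0 : (0 : ℝ) < k := by exact_mod_cast hk
  set s : ℝ := Real.sqrt (1 / (2 * k)) with hs
  have hs0 : 0 ≤ s := Real.sqrt_nonneg _
  have hs2 : s ^ 2 = 1 / (2 * k) := Real.sq_sqrt (by positivity)
  have hsR : s ≤ R := by
    refine abs_le_of_sq_le_sq' ?_ hR0 |>.2
    rw [hs2]
    refine le_trans ?_ hR
    gcongr
    linarith
  have hint : ∀ a b : ℝ, IntervalIntegrable
      (fun r : ℝ => r ^ (2 * n + 1) * (1 - r ^ 2) ^ k) volume a b :=
    fun a b => Continuous.intervalIntegrable (by fun_prop) _ _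
  have htail : 0 ≤ ∫ r in s..R, r ^ (2 * n + 1) * (1 - r ^ 2) ^ k := by
    refine intervalIntegral.integral_nonneg hsR fun r hr => ?_
    have h0 : 0 ≤ r := hs0.trans hr.1
    have h1 : r ≤ 1 := hr.2.trans hR1
    have : 0 ≤ 1 - r ^ 2 := by nlinarith
    positivity
  have hhead : ∫ r in (0 : ℝ)..s, r ^ (2 * n + 1) * (1 / 2) ≤
      ∫ r in (0 : ℝ)..s, r ^ (2 * n + 1) * (1 - r ^ 2) ^ k := by
    refine intervalIntegral.integral_mono_on hs0
      (Continuous.intervalIntegrable (by fun_prop) _ _) (hint _ _) fun r hr => ?_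
    have h0 : 0 ≤ r := hr.1
    have h2 : r ^ 2 ≤ 1 / (2 * k) := hs2 ▸ pow_le_pow_left₀ h0 hr.2 2
    have h3 : k * r ^ 2 ≤ 1 / 2 := by
      calc k * r ^ 2 ≤ k * (1 / (2 * k)) := by gcongr
        _ = 1 / 2 := by field_simp
    have h4 : r ≤ 1 := hr.2.trans (hsR.trans hR1)
    have h5 := one_add_mul_le_pow (a := -r ^ 2) (by nlinarith) k
    rw [← sub_eq_add_neg] at h5
    gcongr
    linarith
  have hval : ∫ r in (0 : ℝ)..s, r ^ (2 * n + 1) * (1 / 2) =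
      (1 / k : ℝ) ^ (n + 1) / (2 ^ (n + 3) * (n + 1)) := by
    rw [intervalIntegral.integral_mul_const, integral_pow,
      show 2 * n + 1 + 1 = 2 * (n + 1) by ring, pow_mul s, hs2, zero_pow (by omega)]
    push_cast
    rw [div_pow, div_pow, mul_pow]
    field_simp
    ring
  have hsplit := intervalIntegral.integral_add_adjacent_intervals (hint 0 s) (hint s R)
  have hle : (1 / k : ℝ) ^ (n + 1) / (2 ^ (n + 3) * (n + 1)) ≤
      ∫ r in (0 : ℝ)..R, r ^ (2 * n + 1) * (1 - r ^ 2) ^ k := by linarith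
  rw [div_le_iff₀ (by positivity)] at hle
  linarith

/-- For `R = log k / √k` the boundary term is smaller than the power `k⁻⁽ⁿ⁺¹⁾`. -/
theorem boundary_term_le (n : ℕ) {k : ℕ} (hk : 1 ≤ k) (hlog : (n + 1 : ℝ) ≤ Real.log k)
    (hsqrt : Real.log k ≤ Real.sqrt k) :
    (Real.log k / Real.sqrt k) ^ (2 * n) * (1 - (Real.log k / Real.sqrt k) ^ 2) ^ (k + 1) ≤
      (1 / k : ℝ) ^ (n + 1) := by
  have hk0 : (0 : ℝ) < k := by exact_mod_cast hk
  have hl0 : 0 ≤ Real.log k := by positivity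
  have hR0 : 0 ≤ Real.log k / Real.sqrt k := by positivity
  have hR1 : Real.log k / Real.sqrt k ≤ 1 := div_le_one_of_le₀ hsqrt (by positivity)
  have hR2 : (Real.log k / Real.sqrt k) ^ 2 = Real.log k ^ 2 / k := by
    rw [div_pow, Real.sq_sqrt hk0.le]
  have hpos : 0 ≤ 1 - (Real.log k / Real.sqrt k) ^ 2 := by nlinarith
  have hle : 1 - (Real.log k / Real.sqrt k) ^ 2 ≤ Real.exp (-(Real.log k ^ 2 / k)) := by
    rw [hR2]
    exact Real.one_sub_le_exp_neg _
  calc _ ≤ 1 * (1 - (Real.log k / Real.sqrt k) ^ 2) ^ k := by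
        refine mul_le_mul (pow_le_one₀ hR0 hR1) ?_ (pow_nonneg hpos _) zero_le_one
        exact pow_le_pow_of_le_one hpos (sub_le_self _ (sq_nonneg _)) (Nat.le_succ k)
    _ ≤ Real.exp (-(Real.log k ^ 2 / k)) ^ k := by
        rw [one_mul]
        gcongr
    _ = Real.exp (-(Real.log k * Real.log k)) := by
        rw [← Real.exp_nat_mul]
        congr 1
        field_simp
    _ ≤ Real.exp (-((n + 1 : ℝ) * Real.log k)) := by gcongr
    _ = (1 / k : ℝ) ^ (n + 1) := by
        rw [Real.exp_neg, one_div, inv_pow]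
        have := Real.exp_nat_mul (Real.log k) (n + 1)
        rw [Real.exp_log hk0] at this
        rw [← this]
        push_cast
        rfl

theorem peak_section_normalisation_ratio
    (n : ℕ) (hn : 1 ≤ n)
    (I J : ℕ → ℝ)
    (hI : ∀ k : ℕ, I k =
      ∫ z in Metric.closedBall (0 : EuclideanSpace ℂ (Fin n))
          (Real.log k / Real.sqrt k), (1 - ‖z‖ ^ 2) ^ k ∂volume)
    (hJ : ∀ k : ℕ, J k =
      ∫ z in Metric.closedBall (0 : EuclideanSpace ℂ (Fin n))
          (Real.log k / Real.sqrt k), ‖z (⟨0, hn⟩ : Fin n)‖ ^ 2 * (1 - ‖z‖ ^ 2) ^ k ∂volume) :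
    ∃ C > (0 : ℝ), ∃ k₀ : ℕ, 2 ≤ k₀ ∧ ∀ k : ℕ, k₀ ≤ k →
      0 < J k ∧ |I k / (k * J k) - 1| ≤ C / k := by
  have hev : ∀ᶠ k : ℕ in Filter.atTop,
      (n + 1 : ℝ) ≤ Real.log k ∧ Real.log k ≤ Real.sqrt k := by
    have hlog := (Real.tendsto_log_atTop.comp tendsto_natCast_atTop_atTop).eventually_ge_atTop
      (n + 1 : ℝ)
    have hsqrt := tendsto_natCast_atTop_atTop.eventually
      ((isLittleO_log_rpow_atTop (show (0 : ℝ) < 1 / 2 by norm_num)).bound one_pos)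
    filter_upwards [hlog, hsqrt] with k h1 h2
    refine ⟨h1, ?_⟩
    rw [one_mul, ← Real.sqrt_eq_rpow, Real.norm_of_nonneg (Real.sqrt_nonneg _)] at h2
    exact (le_abs_self _).trans h2
  obtain ⟨k₁, hk₁⟩ := Filter.eventually_atTop.1 hev
  refine ⟨(n + 1) + 2 ^ (n + 2) * (n + 1), by positivity, max 2 k₁, le_max_left _ _,
    fun k hk => ?_⟩
  obtain ⟨hlog, hsqrt⟩ := hk₁ k ((le_max_right _ _).trans hk)
  have hk1 : 1 ≤ k := le_trans (by norm_num) ((le_max_left 2 k₁).trans hk)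
  have hk0 : (0 : ℝ) < k := by exact_mod_cast hk1
  have hn0 : (0 : ℝ) < n := by exact_mod_cast hn
  have hF := boundary_term_le n hk1 hlog hsqrt
  have hl1 : 1 ≤ Real.log k := by linarith
  have hR0 : 0 ≤ Real.log k / Real.sqrt k := by positivity
  have hR1 : Real.log k / Real.sqrt k ≤ 1 := div_le_one_of_le₀ hsqrt (by positivity)
  have hRk : (1 / k : ℝ) ≤ (Real.log k / Real.sqrt k) ^ 2 := by
    rw [div_pow, Real.sq_sqrt hk0.le]
    gcongr
    exact one_le_pow₀ hl1
  have hI' := hI k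
  have hJ' := hJ k
  set R := Real.log k / Real.sqrt k
  have hB := radial_moment_lower_bound n hk1 hRk hR0 hR1
  have hrec := radial_moment_recursion hn k R
  rw [setIntegral_closedBall_radial hn (fun r => (1 - r ^ 2) ^ k) hR0] at hI'
  have hcoord := mul_setIntegral_closedBall_coord
    (show Continuous fun r : ℝ => (1 - r ^ 2) ^ k by fun_prop) R (⟨0, hn⟩ : Fin n)
  rw [← hJ', setIntegral_closedBall_radial hn (fun r => r ^ 2 * (1 - r ^ 2) ^ k) hR0] at hcoord
  simp_rw [← mul_assoc, ← pow_add, show 2 * n - 1 + 2 = 2 * n + 1 by omega] at hcoord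
  have hvol : 0 < (volume : Measure (EuclideanSpace ℂ (Fin n))).real (Metric.ball 0 1) :=
    ENNReal.toReal_pos (Metric.measure_ball_pos _ _ one_pos).ne' measure_ball_lt_top.ne
  have hF0 : 0 ≤ R ^ (2 * n) * (1 - R ^ 2) ^ (k + 1) := by
    have : 0 ≤ 1 - R ^ 2 := by nlinarith
    positivity
  set v := (volume : Measure (EuclideanSpace ℂ (Fin n))).real (Metric.ball 0 1)
  set A := ∫ r in (0 : ℝ)..R, r ^ (2 * n - 1) * (1 - r ^ 2) ^ k
  set B := ∫ r in (0 : ℝ)..R, r ^ (2 * n + 1) * (1 - r ^ 2) ^ k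
  set F := R ^ (2 * n) * (1 - R ^ 2) ^ (k + 1)
  have hBpos : 0 < B := by
    have : (0 : ℝ) < (1 / k : ℝ) ^ (n + 1) := by positivity
    exact pos_of_mul_pos_right (this.trans_le hB) (by positivity)
  have hJB : J k = 2 * v * B := by
    refine mul_left_cancel₀ hn0.ne' ?_
    linarith
  have hratio : I k / (k * J k) - 1 = ((n + 1) + F / (2 * B)) / k := by
    rw [hI', hJB, show 2 * n * v * A = v * (2 * n * A) by ring, hrec]
    field_simp
    ring
  have hFB : F / (2 * B) ≤ 2 ^ (n + 2) * (n + 1) := by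
    rw [div_le_iff₀ (by positivity)]
    calc F ≤ 2 ^ (n + 3) * (n + 1) * B := hF.trans hB
      _ = _ := by ring
  refine ⟨hJB ▸ by positivity, ?_⟩
  rw [hratio, abs_of_nonneg (by positivity)]
  gcongr
end
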